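/- Cauchy-matrix solutions of the second potential form of the self-dual Yang–Mills equation. Work on ℝ⁴ with coordinates (x¹, x², x̄¹, x̄²). Let a, b be nonzero real constants, and let P = diag(p₁,…,p_r), Q = diag(q₁,…,q_r) be constant diagonal complex matrices with p_i ≠ q_j for all i, j, and with P invertible. Let θ : ℝ⁴ → M_{m×r}(ℂ) and η : ℝ⁴ → M_{r×m}(ℂ) be smooth solutions of a·∂₁̄θ = (∂₂θ)·Q, b·∂₂̄θ = (∂₁θ)·Q, a·∂₁̄η = P·(∂₂η), b·∂₂̄η = P·(∂₁η). Define Ω entrywise by Ω_{ij} := (ηθ)_{ij}/(p_i − q_j) and let g₀ be a constant invertible m×m complex matrix. Then on any open subset of ℝ⁴ where Ω is invertible and g := (I_m − θΩ^{-1}P^{-1}η)·g₀ is invertible, g satisfies b·∂₂( (∂₂̄g) g^{-1} ) − a·∂₁( (∂₁̄g) g^{-1} ) = 0. -/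

import Mathlib

open scoped BigOperators

/-- Partial derivative of a real-valued function on `ℝⁿ` in the `μ`-th coordinate direction. -/
noncomputable def pd {n : ℕ} (μ : Fin n) (f : (Fin n → ℝ) → ℝ) (x : Fin n → ℝ) : ℝ :=
  fderiv ℝ f x (Pi.single μ 1)

/-- Entrywise partial derivative of a matrix-valued function on `ℝⁿ`.
On `ℝ⁴` with coordinates `(x¹, x², x̄¹, x̄²)`, `∂₁ = pdM 0`, `∂₂ = pdM 1`,
`∂₁̄ = pdM 2`, `∂₂̄ = pdM 3`. -/
noncomputable def pdM {n m r : ℕ} (μ : Fin n) (f : (Fin n → ℝ) → Matrix (Fin m) (Fin r) ℂ)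
    (x : Fin n → ℝ) : Matrix (Fin m) (Fin r) ℂ :=
  Matrix.of fun i j => fderiv ℝ (fun y => f y i j) x (Pi.single μ 1)

section PartialDerivatives

variable {n l m r : ℕ} {x : Fin n → ℝ}

/-- Entrywise `C^k` regularity at a point of a matrix-valued function. -/
def EntrywiseContDiffAt (k : WithTop ℕ∞) (f : (Fin n → ℝ) → Matrix (Fin m) (Fin r) ℂ)
    (x : Fin n → ℝ) : Prop :=
  ∀ i j, ContDiffAt ℝ k (fun y => f y i j) x

namespace EntrywiseContDiffAt

variable {k : WithTop ℕ∞}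

theorem const (C : Matrix (Fin m) (Fin r) ℂ) :
    EntrywiseContDiffAt k (fun _ : Fin n → ℝ => C) x :=
  fun _ _ => contDiffAt_const

theorem mul {f : (Fin n → ℝ) → Matrix (Fin l) (Fin m) ℂ}
    {h : (Fin n → ℝ) → Matrix (Fin m) (Fin r) ℂ}
    (hf : EntrywiseContDiffAt k f x) (hh : EntrywiseContDiffAt k h x) :
    EntrywiseContDiffAt k (fun y => f y * h y) x := by
  intro i j
  simp only [Matrix.mul_apply]
  exact ContDiffAt.sum fun s _ => (hf i s).mul (hh s j)

theorem sub {f h : (Fin n → ℝ) → Matrix (Fin m) (Fin r) ℂ}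
    (hf : EntrywiseContDiffAt k f x) (hh : EntrywiseContDiffAt k h x) :
    EntrywiseContDiffAt k (fun y => f y - h y) x :=
  fun i j => (hf i j).sub (hh i j)

theorem det {f : (Fin n → ℝ) → Matrix (Fin r) (Fin r) ℂ}
    (hf : EntrywiseContDiffAt k f x) : ContDiffAt ℝ k (fun y => (f y).det) x := by
  simp only [Matrix.det_apply']
  exact ContDiffAt.sum fun σ _ => contDiffAt_const.mul (contDiffAt_prod fun s _ => hf (σ s) s)

theorem inv {f : (Fin n → ℝ) → Matrix (Fin r) (Fin r) ℂ}
    (hf : EntrywiseContDiffAt k f x) (hx : IsUnit (f x)) :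
    EntrywiseContDiffAt k (fun y => (f y)⁻¹) x := by
  intro i j
  have hdet : (f x).det ≠ 0 := ((Matrix.isUnit_iff_isUnit_det _).1 hx).ne_zero
  simp only [Matrix.inv_def, Ring.inverse_eq_inv', Matrix.smul_apply, Matrix.adjugate_apply,
    smul_eq_mul]
  refine (hf.det.inv hdet).mul (det fun s t => ?_)
  by_cases hs : s = j
  · subst hs
    simpa using contDiffAt_const
  · simpa [Matrix.updateRow_ne hs] using hf s t

theorem differentiableAt {f : (Fin n → ℝ) → Matrix (Fin m) (Fin r) ℂ}
    (hf : EntrywiseContDiffAt 2 f x) (i : Fin m) (j : Fin r) :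
    DifferentiableAt ℝ (fun y => f y i j) x :=
  (hf i j).differentiableAt (by norm_num)

end EntrywiseContDiffAt

theorem pdM_congr {f h : (Fin n → ℝ) → Matrix (Fin m) (Fin r) ℂ} (μ : Fin n)
    (hfh : f =ᶠ[nhds x] h) : pdM μ f x = pdM μ h x := by
  ext i j
  have : (fun y => f y i j) =ᶠ[nhds x] fun y => h y i j := by
    filter_upwards [hfh] with y hy
    rw [hy]
  simp [pdM, this.fderiv_eq]

theorem pdM_const (μ : Fin n) (C : Matrix (Fin m) (Fin r) ℂ) : pdM μ (fun _ => C) x = 0 := by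
  ext i j
  simp [pdM]

theorem pdM_const_smul (μ : Fin n) (c : ℝ) (f : (Fin n → ℝ) → Matrix (Fin m) (Fin r) ℂ) :
    pdM μ (fun y => c • f y) x = c • pdM μ f x := by
  ext i j
  simp only [pdM, Matrix.of_apply, Matrix.smul_apply]
  exact congrArg (fun L => L x (Pi.single μ 1))
    (fderiv_const_smul_field (𝕜 := ℝ) (f := fun y => f y i j) c)

theorem pdM_sub (μ : Fin n) {f h : (Fin n → ℝ) → Matrix (Fin m) (Fin r) ℂ}
    (hf : EntrywiseContDiffAt 2 f x) (hh : EntrywiseContDiffAt 2 h x) :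
    pdM μ (fun y => f y - h y) x = pdM μ f x - pdM μ h x := by
  ext i j
  simp [pdM, fderiv_fun_sub (hf.differentiableAt i j) (hh.differentiableAt i j)]

theorem pdM_mul (μ : Fin n) {f : (Fin n → ℝ) → Matrix (Fin l) (Fin m) ℂ}
    {h : (Fin n → ℝ) → Matrix (Fin m) (Fin r) ℂ}
    (hf : EntrywiseContDiffAt 2 f x) (hh : EntrywiseContDiffAt 2 h x) :
    pdM μ (fun y => f y * h y) x = pdM μ f x * h x + f x * pdM μ h x := by
  ext i j
  simp only [pdM, Matrix.of_apply, Matrix.add_apply, Matrix.mul_apply]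
  rw [fderiv_fun_sum fun s _ => (hf.differentiableAt i s).fun_mul (hh.differentiableAt s j),
    ← Finset.sum_add_distrib, sum_apply]
  refine Finset.sum_congr rfl fun s _ => ?_
  rw [fderiv_fun_mul (hf.differentiableAt i s) (hh.differentiableAt s j)]
  simp only [add_apply, smul_apply, smul_eq_mul]
  ring

theorem pdM_inv (μ : Fin n) {f : (Fin n → ℝ) → Matrix (Fin r) (Fin r) ℂ}
    (hf : EntrywiseContDiffAt 2 f x) (hx : IsUnit (f x)) (hU : ∀ᶠ y in nhds x, IsUnit (f y)) :
    pdM μ (fun y => (f y)⁻¹) x = -((f x)⁻¹ * pdM μ f x * (f x)⁻¹) := by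
  have h1 : pdM μ (fun y => f y * (f y)⁻¹) x = 0 := by
    rw [← pdM_const (x := x) μ (1 : Matrix (Fin r) (Fin r) ℂ)]
    refine pdM_congr μ ?_
    filter_upwards [hU] with y hy
    exact Matrix.mul_nonsing_inv _ ((Matrix.isUnit_iff_isUnit_det _).1 hy)
  rw [pdM_mul μ hf (hf.inv hx)] at h1
  have h2 := congrArg ((f x)⁻¹ * ·) h1
  simp only [Matrix.mul_add, Matrix.mul_zero] at h2
  rw [Matrix.nonsing_inv_mul_cancel_left _ _ ((Matrix.isUnit_iff_isUnit_det _).1 hx),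
    ← Matrix.mul_assoc] at h2
  exact eq_neg_of_add_eq_zero_right h2

theorem pdM_comm (μ ν : Fin n) {f : (Fin n → ℝ) → Matrix (Fin m) (Fin r) ℂ}
    (hf : EntrywiseContDiffAt 2 f x) :
    pdM μ (pdM ν f) x = pdM ν (pdM μ f) x := by
  ext i j
  have hd : DifferentiableAt ℝ (fderiv ℝ fun y => f y i j) x :=
    ((hf i j).fderiv_right (m := 1) (by norm_num)).differentiableAt (by norm_num)
  have key : ∀ α β : Fin n, pdM α (pdM β f) x i j =
      fderiv ℝ (fderiv ℝ fun y => f y i j) x (Pi.single α 1) (Pi.single β 1) := by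
    intro α β
    simp only [pdM, Matrix.of_apply]
    rw [fderiv_clm_apply hd (differentiableAt_const _)]
    simp
  rw [key, key]
  exact (hf i j).isSymmSndFDerivAt (by simp) _ _

end PartialDerivatives

section CauchyMatrix

variable {m r : ℕ}

/-- The Sylvester equation `PΩ - ΩQ = ηθ` turns the derivation formulas for `θ`, `Ω`, `η` into the
factorization `D̄u = -(Dv) u` with `u = 1 - θΩ⁻¹P⁻¹η` and `v = θΩ⁻¹η`. -/
theorem sylvester_factorization
    {θ Dθ : Matrix (Fin m) (Fin r) ℂ} {η Dη : Matrix (Fin r) (Fin m) ℂ}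
    {W Ω DΩ P P' Q : Matrix (Fin r) (Fin r) ℂ}
    (hW : W * Ω = 1) (hW' : Ω * W = 1) (hP : P * P' = 1) (hP' : P' * P = 1)
    (hS : P * Ω - Ω * Q = η * θ) :
    Dθ * Q * W * P' * η + θ * -(W * (DΩ * Q + Dη * θ) * W) * P' * η + θ * W * P' * (P * Dη) =
      (Dθ * W * η + θ * -(W * DΩ * W) * η + θ * W * Dη) * (1 - θ * W * P' * η) := by
  have hQW : Q * W = W * P - W * (η * θ) * W := by
    rw [← hS, Matrix.mul_sub, Matrix.sub_mul, ← Matrix.mul_assoc W Ω Q, hW, Matrix.one_mul,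
      Matrix.mul_assoc W (P * Ω) W, Matrix.mul_assoc P Ω W, hW', Matrix.mul_one]
    abel
  have hQη : Q * (W * (P' * η)) = W * η - W * (η * (θ * (W * (P' * η)))) := by
    rw [← Matrix.mul_assoc Q, hQW, Matrix.sub_mul, Matrix.mul_assoc W P, ← Matrix.mul_assoc P, hP,
      Matrix.one_mul]
    simp only [Matrix.mul_assoc]
  have hPη : P' * (P * Dη) = Dη := by rw [← Matrix.mul_assoc, hP', Matrix.one_mul]
  simp only [Matrix.mul_assoc, Matrix.add_mul, Matrix.mul_add, Matrix.mul_sub, Matrix.neg_mul,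
    Matrix.mul_neg, hQη, hPη, Matrix.mul_one]
  abel

variable {n : ℕ} {x : Fin n → ℝ} {p q : Fin r → ℂ}
  {θ : (Fin n → ℝ) → Matrix (Fin m) (Fin r) ℂ} {η : (Fin n → ℝ) → Matrix (Fin r) (Fin m) ℂ}

/-- The solution of the Sylvester equation `PΩ - ΩQ = ηθ` with diagonal `P` and `Q`. -/
noncomputable def cauchyMatrix (p q : Fin r → ℂ) (θ : (Fin n → ℝ) → Matrix (Fin m) (Fin r) ℂ)
    (η : (Fin n → ℝ) → Matrix (Fin r) (Fin m) ℂ) (x : Fin n → ℝ) : Matrix (Fin r) (Fin r) ℂ :=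
  Matrix.of fun i j => (η x * θ x) i j / (p i - q j)

theorem cauchyMatrix_sylvester (hpq : ∀ i j, p i ≠ q j) :
    Matrix.diagonal p * cauchyMatrix p q θ η x - cauchyMatrix p q θ η x * Matrix.diagonal q =
      η x * θ x := by
  ext i j
  have := sub_ne_zero.2 (hpq i j)
  simp only [cauchyMatrix, Matrix.sub_apply, Matrix.diagonal_mul, Matrix.mul_diagonal,
    Matrix.of_apply]
  field_simp

theorem EntrywiseContDiffAt.cauchyMatrix {k : WithTop ℕ∞} (hθ : EntrywiseContDiffAt k θ x)
    (hη : EntrywiseContDiffAt k η x) : EntrywiseContDiffAt k (cauchyMatrix p q θ η) x :=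
  fun i j => ((hη.mul hθ) i j).div_const _

theorem pdM_cauchyMatrix (μ : Fin n) (hθ : EntrywiseContDiffAt 2 θ x)
    (hη : EntrywiseContDiffAt 2 η x) :
    pdM μ (cauchyMatrix p q θ η) x =
      Matrix.of fun i j => (pdM μ η x * θ x + η x * pdM μ θ x) i j / (p i - q j) := by
  ext i j
  rw [← pdM_mul μ hη hθ]
  simp only [pdM, cauchyMatrix, Matrix.of_apply, div_eq_mul_inv]
  rw [fderiv_mul_const ((hη.mul hθ).differentiableAt i j)]
  simp [mul_comm]

theorem smul_pdM_cauchyMatrix {c : ℝ} {μ ν : Fin n} (hpq : ∀ i j, p i ≠ q j)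
    (hθ : EntrywiseContDiffAt 2 θ x) (hη : EntrywiseContDiffAt 2 η x)
    (hθν : c • pdM ν θ x = pdM μ θ x * Matrix.diagonal q)
    (hην : c • pdM ν η x = Matrix.diagonal p * pdM μ η x) :
    c • pdM ν (cauchyMatrix p q θ η) x =
      pdM μ (cauchyMatrix p q θ η) x * Matrix.diagonal q + pdM μ η x * θ x := by
  have h : c • (pdM ν η x * θ x + η x * pdM ν θ x) =
      Matrix.diagonal p * (pdM μ η x * θ x) + η x * pdM μ θ x * Matrix.diagonal q := by
    rw [smul_add, ← Matrix.smul_mul, ← Matrix.mul_smul, hθν, hην, Matrix.mul_assoc,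
      Matrix.mul_assoc]
  rw [pdM_cauchyMatrix ν hθ hη, pdM_cauchyMatrix μ hθ hη]
  ext i j
  have hij := congrFun₂ h i j
  have hne := sub_ne_zero.2 (hpq i j)
  simp only [Matrix.smul_apply, Matrix.add_apply, Matrix.diagonal_mul, Matrix.mul_diagonal,
    Matrix.of_apply, Complex.real_smul] at hij ⊢
  rw [← mul_div_assoc, hij]
  field_simp
  ring

/-- `(D̄g) g⁻¹` is a total derivative: the potential is `-θΩ⁻¹η`. -/
theorem smul_pdM_mul_inv {c : ℝ} {μ ν : Fin n} (hpq : ∀ i j, p i ≠ q j)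
    (hP : IsUnit (Matrix.diagonal p))
    (hθ : EntrywiseContDiffAt 2 θ x) (hη : EntrywiseContDiffAt 2 η x)
    (hθν : c • pdM ν θ x = pdM μ θ x * Matrix.diagonal q)
    (hην : c • pdM ν η x = Matrix.diagonal p * pdM μ η x)
    (g₀ : Matrix (Fin m) (Fin m) ℂ)
    {g : (Fin n → ℝ) → Matrix (Fin m) (Fin m) ℂ}
    (hg : g = fun y =>
      (1 - θ y * (cauchyMatrix p q θ η y)⁻¹ * (Matrix.diagonal p)⁻¹ * η y) * g₀)
    (hx : IsUnit (cauchyMatrix p q θ η x))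
    (hU : ∀ᶠ y in nhds x, IsUnit (cauchyMatrix p q θ η y)) (hgx : IsUnit (g x)) :
    c • (pdM ν g x * (g x)⁻¹) =
      -pdM μ (fun y => θ y * (cauchyMatrix p q θ η y)⁻¹ * η y) x := by
  have hΩ : EntrywiseContDiffAt 2 (cauchyMatrix p q θ η) x := hθ.cauchyMatrix hη
  have hW := hΩ.inv hx
  have hθW := hθ.mul hW
  have hC := EntrywiseContDiffAt.const (k := 2) (x := x) (Matrix.diagonal p)⁻¹
  have hθWP := hθW.mul hC
  have h1 := EntrywiseContDiffAt.const (k := 2) (x := x) (1 : Matrix (Fin m) (Fin m) ℂ)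
  have hv : pdM μ (fun y => θ y * (cauchyMatrix p q θ η y)⁻¹ * η y) x * g x = -(c • pdM ν g x) := by
    have hx' := (Matrix.isUnit_iff_isUnit_det _).1 hx
    have hP' := (Matrix.isUnit_iff_isUnit_det _).1 hP
    have key := sylvester_factorization (Dθ := pdM μ θ x) (Dη := pdM μ η x)
      (DΩ := pdM μ (cauchyMatrix p q θ η) x)
      (Matrix.nonsing_inv_mul _ hx') (Matrix.mul_nonsing_inv _ hx') (Matrix.mul_nonsing_inv _ hP')
      (Matrix.nonsing_inv_mul _ hP') (cauchyMatrix_sylvester (θ := θ) (η := η) (x := x) hpq)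
    rw [← smul_pdM_cauchyMatrix hpq hθ hη hθν hην, ← hθν, ← hην] at key
    rw [hg, pdM_mul ν (h1.sub (hθWP.mul hη)) (.const g₀), pdM_sub ν h1 (hθWP.mul hη),
      pdM_mul ν hθWP hη, pdM_mul ν hθW hC, pdM_mul ν hθ hW, pdM_inv ν hΩ hx hU, pdM_const,
      pdM_const, pdM_const, pdM_mul μ hθW hη, pdM_mul μ hθ hW, pdM_inv μ hΩ hx hU,
      ← Matrix.mul_assoc, Matrix.add_mul (pdM μ θ x * _), ← key]
    simp only [Matrix.mul_zero, add_zero, zero_sub, Matrix.add_mul, Matrix.neg_mul,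
      Matrix.mul_neg, Matrix.smul_mul, Matrix.mul_smul, smul_neg, smul_add, neg_neg, neg_add_rev]
  have hgx' := (Matrix.isUnit_iff_isUnit_det _).1 hgx
  rw [← Matrix.smul_mul, ← neg_neg (c • pdM ν g x), ← hv, Matrix.neg_mul,
    Matrix.mul_nonsing_inv_cancel_right _ _ hgx']

end CauchyMatrix

/-- Cauchy-matrix solutions of the second potential form of the self-dual
Yang–Mills equation `b·∂₂((∂₂̄g)g⁻¹) − a·∂₁((∂₁̄g)g⁻¹) = 0`. -/
theorem statement15 {m r : ℕ} (a b : ℝ) (ha : a ≠ 0) (hb : b ≠ 0)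
    (p q : Fin r → ℂ) (hpq : ∀ i j, p i ≠ q j)
    (hPinv : IsUnit (Matrix.diagonal p))
    (θ : (Fin 4 → ℝ) → Matrix (Fin m) (Fin r) ℂ)
    (η : (Fin 4 → ℝ) → Matrix (Fin r) (Fin m) ℂ)
    (hθs : ∀ i j, ContDiff ℝ (⊤ : ℕ∞) (fun y => θ y i j))
    (hηs : ∀ i j, ContDiff ℝ (⊤ : ℕ∞) (fun y => η y i j))
    (hθ1 : ∀ x, a • pdM 2 θ x = pdM 1 θ x * Matrix.diagonal q)
    (hθ2 : ∀ x, b • pdM 3 θ x = pdM 0 θ x * Matrix.diagonal q)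
    (hη1 : ∀ x, a • pdM 2 η x = Matrix.diagonal p * pdM 1 η x)
    (hη2 : ∀ x, b • pdM 3 η x = Matrix.diagonal p * pdM 0 η x)
    (Ω : (Fin 4 → ℝ) → Matrix (Fin r) (Fin r) ℂ)
    (hΩ : Ω = fun x => Matrix.of fun i j => (η x * θ x) i j / (p i - q j))
    (g₀ : Matrix (Fin m) (Fin m) ℂ) (hg₀ : IsUnit g₀)
    (g : (Fin 4 → ℝ) → Matrix (Fin m) (Fin m) ℂ)
    (hg : g = fun x =>
        ((1 : Matrix (Fin m) (Fin m) ℂ) - θ x * (Ω x)⁻¹ * (Matrix.diagonal p)⁻¹ * η x) * g₀) :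
    ∀ V : Set (Fin 4 → ℝ), IsOpen V → (∀ x ∈ V, IsUnit (Ω x)) → (∀ x ∈ V, IsUnit (g x)) →
      ∀ x ∈ V,
        b • pdM 1 (fun y => pdM 3 g y * (g y)⁻¹) x
          - a • pdM 0 (fun y => pdM 2 g y * (g y)⁻¹) x = 0 := by
  intro V hV hΩV hgV x hxV
  replace hΩ : Ω = cauchyMatrix p q θ η := hΩ
  subst hΩ
  have hθ (y) : EntrywiseContDiffAt 2 θ y := fun i j =>
    (hθs i j).contDiffAt.of_le (WithTop.coe_le_coe.2 le_top)
  have hη (y) : EntrywiseContDiffAt 2 η y := fun i j =>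
    (hηs i j).contDiffAt.of_le (WithTop.coe_le_coe.2 le_top)
  have hU {y} (hy : y ∈ V) : ∀ᶠ z in nhds y, IsUnit (cauchyMatrix p q θ η z) :=
    Filter.eventually_of_mem (hV.mem_nhds hy) hΩV
  have hv : EntrywiseContDiffAt 2 (fun y => θ y * (cauchyMatrix p q θ η y)⁻¹ * η y) x :=
    ((hθ x).mul (((hθ x).cauchyMatrix (hη x)).inv (hΩV x hxV))).mul (hη x)
  have h₂ : (fun y => b • (pdM 3 g y * (g y)⁻¹)) =ᶠ[nhds x]
      fun y => (-1 : ℝ) • pdM 0 (fun y => θ y * (cauchyMatrix p q θ η y)⁻¹ * η y) y := by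
    filter_upwards [hV.mem_nhds hxV] with y hy
    rw [neg_one_smul]
    exact smul_pdM_mul_inv hpq hPinv (hθ y) (hη y) (hθ2 y) (hη2 y) g₀ hg (hΩV y hy) (hU hy)
      (hgV y hy)
  have h₁ : (fun y => a • (pdM 2 g y * (g y)⁻¹)) =ᶠ[nhds x]
      fun y => (-1 : ℝ) • pdM 1 (fun y => θ y * (cauchyMatrix p q θ η y)⁻¹ * η y) y := by
    filter_upwards [hV.mem_nhds hxV] with y hy
    rw [neg_one_smul]
    exact smul_pdM_mul_inv hpq hPinv (hθ y) (hη y) (hθ1 y) (hη1 y) g₀ hg (hΩV y hy) (hU hy)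
      (hgV y hy)
  rw [← pdM_const_smul, ← pdM_const_smul, pdM_congr 1 h₂, pdM_congr 0 h₁, pdM_const_smul,
    pdM_const_smul, pdM_comm 1 0 hv, sub_self]
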